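/- Suppose l(p) = 0, l'(p) = 0 and η'(p) = 0. Then γ''(p) = 0, det(γ'''(p), γ⁽⁴⁾(p)) = 0, and det(γ'''(p), γ⁽⁵⁾(p)) ≠ 0 if and only if η''(p)·l''(p) ≠ 0. (By the cusp criterion, this says γ has a 5/3-cusp at p if and only if η''(p)·l''(p) ≠ 0.) -/

import Mathlib

open Real

/-- Rotation of the plane by angle `θ`. -/
noncomputable def rot (θ : ℝ) (v : ℝ × ℝ) : ℝ × ℝ :=
  (Real.cos θ * v.1 - Real.sin θ * v.2, Real.sin θ * v.1 + Real.cos θ * v.2)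

/-- Determinant of the 2×2 matrix with columns `v`, `w`. -/
def det2 (v w : ℝ × ℝ) : ℝ := v.1 * w.2 - v.2 * w.1

open scoped ContDiff

lemma hasDerivAt_of_eq_integral {f g : ℝ → ℝ} (hg : Continuous g)
    (hf : ∀ t, f t = ∫ u in (0:ℝ)..t, g u) (t : ℝ) : HasDerivAt f (g t) t := by
  rw [funext hf]
  exact hg.integral_hasStrictDerivAt 0 t |>.hasDerivAt

lemma contDiff_infty_of_hasDerivAt {f g : ℝ → ℝ} (hg : ContDiff ℝ ∞ g)
    (hf : ∀ t, HasDerivAt f (g t) t) : ContDiff ℝ ∞ f := by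
  rw [contDiff_infty_iff_deriv, show deriv f = g from funext fun t => (hf t).deriv]
  exact ⟨fun t => (hf t).differentiableAt, hg⟩

lemma iteratedDeriv_prodMk {f g : ℝ → ℝ} (hf : ContDiff ℝ ∞ f) (hg : ContDiff ℝ ∞ g)
    (n : ℕ) :
    iteratedDeriv n (fun t => (f t, g t)) =
      fun t => (iteratedDeriv n f t, iteratedDeriv n g t) := by
  induction n with
  | zero => simp
  | succ n ih =>
    funext t
    have hn : (n : ℕ∞ω) < ∞ := by exact_mod_cast ENat.natCast_lt_top n
    simp only [iteratedDeriv_succ, ih]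
    exact ((hf.differentiable_iteratedDeriv n hn t).hasDerivAt.prodMk
      (hg.differentiable_iteratedDeriv n hn t).hasDerivAt).deriv

/-- Jet of a product `l * A` at a point where `l`, `l'` and `A'` vanish. -/
lemma iteratedDeriv_mul_of_vanishing {l A : ℝ → ℝ} (hl : ContDiff ℝ ∞ l)
    (hA : ContDiff ℝ ∞ A) {p : ℝ} (hlp : l p = 0) (hl' : deriv l p = 0)
    (hA' : deriv A p = 0) :
    iteratedDeriv 1 (fun t => l t * A t) p = 0 ∧
    iteratedDeriv 2 (fun t => l t * A t) p = iteratedDeriv 2 l p * A p ∧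
    iteratedDeriv 3 (fun t => l t * A t) p = iteratedDeriv 3 l p * A p ∧
    iteratedDeriv 4 (fun t => l t * A t) p =
      iteratedDeriv 4 l p * A p + 6 * iteratedDeriv 2 l p * iteratedDeriv 2 A p := by
  have leibniz (n : ℕ) := iteratedDeriv_fun_mul (n := n) (x := p)
    (hl.contDiffAt.of_le (by exact_mod_cast le_top))
    (hA.contDiffAt.of_le (by exact_mod_cast le_top))
  refine ⟨?_, ?_, ?_, ?_⟩ <;>
    simp [leibniz, Finset.sum_range_succ, Nat.choose, hlp, hl', hA', iteratedDeriv_one]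
  ring

/-- A curve with velocity `l • (A, B)`, where `(A, B)` is a unit vector field rotating at
rate `-k`, at a common zero of `l`, `l'` and `k`. -/
lemma cusp_53_of_frame {l A B k x y : ℝ → ℝ} (hl : ContDiff ℝ ∞ l)
    (hA : ContDiff ℝ ∞ A) (hB : ContDiff ℝ ∞ B)
    (hx : ∀ t, HasDerivAt x (l t * A t) t) (hy : ∀ t, HasDerivAt y (l t * B t) t)
    (hA' : ∀ t, HasDerivAt A (k t * B t) t) (hB' : ∀ t, HasDerivAt B (-(k t * A t)) t)
    {p κ : ℝ} (hAB : A p ^ 2 + B p ^ 2 = 1) (hlp : l p = 0) (hl' : deriv l p = 0)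
    (hkp : k p = 0) (hk' : HasDerivAt k κ p) :
    iteratedDeriv 2 (fun t => (x t, y t)) p = 0 ∧
    det2 (iteratedDeriv 3 (fun t => (x t, y t)) p)
      (iteratedDeriv 4 (fun t => (x t, y t)) p) = 0 ∧
    det2 (iteratedDeriv 3 (fun t => (x t, y t)) p)
      (iteratedDeriv 5 (fun t => (x t, y t)) p) = -6 * iteratedDeriv 2 l p ^ 2 * κ := by
  have hγ' : deriv (fun t => (x t, y t)) = fun t => (l t * A t, l t * B t) :=
    funext fun t => ((hx t).prodMk (hy t)).deriv
  have hγ (n : ℕ) : iteratedDeriv (n + 1) (fun t => (x t, y t)) p =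
      (iteratedDeriv n (fun t => l t * A t) p, iteratedDeriv n (fun t => l t * B t) p) := by
    rw [iteratedDeriv_succ', hγ', iteratedDeriv_prodMk (hl.mul hA) (hl.mul hB)]
  have hA2 : iteratedDeriv 2 A p = κ * B p := by
    rw [iteratedDeriv_succ, iteratedDeriv_one, funext fun t => (hA' t).deriv,
      (hk'.fun_mul (hB' p)).deriv, hkp]
    ring
  have hB2 : iteratedDeriv 2 B p = -(κ * A p) := by
    rw [iteratedDeriv_succ, iteratedDeriv_one, funext fun t => (hB' t).deriv,
      (hk'.fun_mul (hA' p)).fun_neg.deriv, hkp]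
    ring
  obtain ⟨a1, a2, a3, a4⟩ := iteratedDeriv_mul_of_vanishing hl hA hlp hl'
    (by rw [(hA' p).deriv, hkp, zero_mul])
  obtain ⟨b1, b2, b3, b4⟩ := iteratedDeriv_mul_of_vanishing hl hB hlp hl'
    (by rw [(hB' p).deriv, hkp, zero_mul, neg_zero])
  refine ⟨?_, ?_, ?_⟩
  · rw [hγ 1, a1, b1]; rfl
  · rw [hγ 2, hγ 3, a2, b2, a3, b3, det2]; ring
  · rw [hγ 2, hγ 4, a2, b2, a4, b4, hA2, hB2, det2]
    linear_combination -6 * iteratedDeriv 2 l p ^ 2 * κ * hAB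

/-- Criterion for a 5/3-cusp of `γ` at a singular point `p` with `l'(p) = 0` and
`η'(p) = 0`: `det(γ'''(p), γ⁽⁵⁾(p)) ≠ 0` iff `η''(p) l''(p) ≠ 0`. -/
theorem cusp_53_criterion
    (l h : ℝ → ℝ) (hl : ContDiff ℝ (⊤ : ℕ∞) l) (hh : ContDiff ℝ (⊤ : ℕ∞) h)
    (η F G : ℝ → ℝ)
    (hη : ∀ u, η u = ∫ v in (0:ℝ)..u, 2 * h v)
    (hF : ∀ t, F t = ∫ u in (0:ℝ)..t, l u * sin (η u))
    (hG : ∀ t, G t = ∫ u in (0:ℝ)..t, l u * cos (η u))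
    (c₁ c₂ : ℝ)
    (hpos : ∀ t, 0 < (F t - c₁) ^ 2 + (G t - c₂) ^ 2)
    (y x : ℝ → ℝ)
    (hy : ∀ t, y t = Real.sqrt ((F t - c₁) ^ 2 + (G t - c₂) ^ 2))
    (hx : ∀ t, x t = ∫ u in (0:ℝ)..t,
      (deriv F u * (G u - c₂) - deriv G u * (F u - c₁)) / y u)
    (γ : ℝ → ℝ × ℝ) (hγ : ∀ t, γ t = (x t, y t))
    (U : ℝ → ℝ × ℝ) (hU : ∀ t, U t = (-(F t - c₁), G t - c₂))
    (p : ℝ) (hlp : l p = 0) (hl' : deriv l p = 0) (hη' : deriv η p = 0) :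
    iteratedDeriv 2 γ p = 0 ∧
    det2 (iteratedDeriv 3 γ p) (iteratedDeriv 4 γ p) = 0 ∧
    (det2 (iteratedDeriv 3 γ p) (iteratedDeriv 5 γ p) ≠ 0 ↔
      iteratedDeriv 2 η p * iteratedDeriv 2 l p ≠ 0) := by
  have dη (t) : HasDerivAt η (2 * h t) t :=
    hasDerivAt_of_eq_integral (continuous_const.mul hh.continuous) hη t
  have cη : ContDiff ℝ ∞ η := contDiff_infty_of_hasDerivAt (contDiff_const.mul hh) dη
  have cF' : ContDiff ℝ ∞ fun u => l u * sin (η u) := hl.mul cη.sin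
  have cG' : ContDiff ℝ ∞ fun u => l u * cos (η u) := hl.mul cη.cos
  have dF := hasDerivAt_of_eq_integral cF'.continuous hF
  have dG := hasDerivAt_of_eq_integral cG'.continuous hG
  have cF := contDiff_infty_of_hasDerivAt cF' dF
  have cG := contDiff_infty_of_hasDerivAt cG' dG
  have y_pos (t) : 0 < y t := hy t ▸ Real.sqrt_pos.2 (hpos t)
  have y_ne (t) : y t ≠ 0 := (y_pos t).ne'
  have y_sq (t) : y t ^ 2 = (F t - c₁) ^ 2 + (G t - c₂) ^ 2 := by
    rw [hy, Real.sq_sqrt (hpos t).le]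
  have cy : ContDiff ℝ ∞ y := by
    rw [funext hy]
    exact (((cF.sub contDiff_const).pow 2).add ((cG.sub contDiff_const).pow 2)).sqrt
      fun t => (hpos t).ne'
  set A : ℝ → ℝ := fun t => (sin (η t) * (G t - c₂) - cos (η t) * (F t - c₁)) / y t with hA
  set B : ℝ → ℝ := fun t => (sin (η t) * (F t - c₁) + cos (η t) * (G t - c₂)) / y t with hB
  have cA : ContDiff ℝ ∞ A :=
    ((cη.sin.mul (cG.sub contDiff_const)).sub (cη.cos.mul (cF.sub contDiff_const))).div cy y_ne
  have cB : ContDiff ℝ ∞ B :=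
    ((cη.sin.mul (cF.sub contDiff_const)).add (cη.cos.mul (cG.sub contDiff_const))).div cy y_ne
  have yA (t) : sin (η t) * (G t - c₂) - cos (η t) * (F t - c₁) = A t * y t :=
    (div_mul_cancel₀ _ (y_ne t)).symm
  have yB (t) : sin (η t) * (F t - c₁) + cos (η t) * (G t - c₂) = B t * y t :=
    (div_mul_cancel₀ _ (y_ne t)).symm
  have hAB (t) : A t ^ 2 + B t ^ 2 = 1 := by
    have : (A t ^ 2 + B t ^ 2) * y t ^ 2 = 1 * y t ^ 2 := by
      calc _ = (A t * y t) ^ 2 + (B t * y t) ^ 2 := by ring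
        _ = _ := by
          rw [← yA, ← yB, y_sq]
          linear_combination ((F t - c₁) ^ 2 + (G t - c₂) ^ 2) * sin_sq_add_cos_sq (η t)
    exact mul_right_cancel₀ (pow_ne_zero 2 (y_ne t)) this
  have dx (t) : HasDerivAt x (l t * A t) t := by
    refine hasDerivAt_of_eq_integral (hl.mul cA).continuous (fun s => ?_) t
    rw [hx]
    congr 1 with u
    rw [(dF u).deriv, (dG u).deriv, hA]
    ring
  have dy (t) : HasDerivAt y (l t * B t) t := by
    have h1 := (((dF t).sub_const c₁).fun_pow 2).fun_add (((dG t).sub_const c₂).fun_pow 2)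
    have h2 := h1.sqrt (hpos t).ne'
    rw [← funext hy, ← hy] at h2
    refine h2.congr_deriv ?_
    have := y_ne t
    simp only [hB]
    push_cast
    field_simp
  have dA (t) : HasDerivAt A ((2 * h t - l t * (A t / y t)) * B t) t := by
    have h1 := (((dη t).sin.fun_mul ((dG t).sub_const c₂)).fun_sub
      ((dη t).cos.fun_mul ((dF t).sub_const c₁))).fun_div (dy t) (y_ne t)
    refine h1.congr_deriv ?_
    rw [yA]
    have := y_ne t
    field_simp
    linear_combination 2 * h t * yB t
  have dB (t) : HasDerivAt B (-((2 * h t - l t * (A t / y t)) * A t)) t := by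
    have h1 := (((dη t).sin.fun_mul ((dF t).sub_const c₁)).fun_add
      ((dη t).cos.fun_mul ((dG t).sub_const c₂))).fun_div (dy t) (y_ne t)
    refine h1.congr_deriv ?_
    rw [yB]
    have := y_ne t
    field_simp
    linear_combination -2 * h t * yA t + l t * sin_sq_add_cos_sq (η t) - l t * hAB t
  have dη' : deriv η = fun t => 2 * h t := funext fun t => (dη t).deriv
  have hhp : 2 * h p = 0 := by rw [← hη', dη']
  have dk : HasDerivAt (fun t => 2 * h t - l t * (A t / y t)) (iteratedDeriv 2 η p) p := by
    have h1 : HasDerivAt (fun t => 2 * h t) (iteratedDeriv 2 η p) p := by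
      rw [iteratedDeriv_succ, iteratedDeriv_one, dη']
      exact ((contDiff_const.mul hh).differentiable (by simp) p).hasDerivAt
    have h2 := (hl.differentiable (by simp) p).hasDerivAt.fun_mul
      ((dA p).fun_div (dy p) (y_ne p))
    refine (h1.fun_sub h2).congr_deriv ?_
    rw [hlp, hl']
    ring
  obtain ⟨h2, h34, h35⟩ := cusp_53_of_frame hl cA cB dx dy dA dB (hAB p) hlp hl'
    (by rw [hhp, hlp]; ring) dk
  rw [funext hγ]
  refine ⟨h2, h34, ?_⟩
  rw [h35]
  simp [and_comm]
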